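/- Let W be a word with X-letters x_1, ..., x_n, and let a < b be indices such that lambda(x_a) = lambda(x_b) and lambda(x_j) != lambda(x_a) for every j with a < j < b. Then the subword W_a^b is a primitive disk word. Consequently, for any two indices a < b with lambda(x_a) = lambda(x_b), there exist indices a = d_1 < d_2 < ... < d_m = b such that each subword W_{d_i}^{d_{i+1}} is a primitive disk word. (This is the combinatorial core of Lemma 5.2: X-letters at equal level are connected by chains of primitive disk words.) -/

import Mathlib

/-- A letter of the alphabet `{X, X⁻¹, Y, Y⁻¹}`. -/
inductive L where
  | X | Xi | Y | Yi
deriving DecidableEq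

/-- A word is a finite sequence of letters. -/
abbrev Word := List L

/-- Whether a letter is an `X`-letter, i.e. `X` or `X⁻¹`. -/
def L.isX : L → Bool
  | .X => true
  | .Xi => true
  | _ => false

/-- The sign of a letter: `+1` for `X`, `-1` for `X⁻¹`, `0` for `Y`-letters. -/
def L.sgn : L → ℤ
  | .X => 1
  | .Xi => -1
  | _ => 0

/-- The formal inverse of a letter. -/
def L.inv : L → L
  | .X => .Xi
  | .Xi => .X
  | .Y => .Yi
  | .Yi => .Y

/-- `phi W` = (number of `X`'s in `W`) - (number of `X⁻¹`'s in `W`). -/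
def phi (w : Word) : ℤ := (w.map L.sgn).sum

/-- The subsequence of `X`-letters `x₁, …, xₙ` of a word. -/
def xLetters (w : Word) : Word := w.filter (·.isX)

/-- The number `n` of `X`-letters of a word. -/
def numX (w : Word) : ℕ := (xLetters w).length

/-- The `i`-th `X`-letter `xᵢ` of a word (1-indexed; junk value `Y` out of range). -/
def xLtr (w : Word) (i : ℕ) : L := (xLetters w).getD (i - 1) L.Y

/-- `phi (W₁ⁱ)`: the sign-sum of the first `i` `X`-letters of `W`. -/
def phiPrefix (w : Word) (i : ℕ) : ℤ := (((xLetters w).take i).map L.sgn).sum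

/-- `W` is a disk word: it has `n ≥ 2` `X`-letters, its first letter is `x₁`,
its last letter is `xₙ`, `x₁` and `xₙ` have opposite signs, and `phi W = 0`. -/
def IsDiskWord (w : Word) : Prop :=
  2 ≤ numX w ∧
  w.head? = (xLetters w).head? ∧
  w.getLast? = (xLetters w).getLast? ∧
  phi w = 0 ∧
  (xLtr w 1).sgn = -(xLtr w (numX w)).sgn

/-- A disk word `W = W₁ⁿ` is primitive if `phi (W₁ᵏ) ≠ 0` for all `1 < k < n`. -/
def IsPrimitive (w : Word) : Prop :=
  IsDiskWord w ∧ ∀ k, 1 < k → k < numX w → phiPrefix w k ≠ 0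

/-- A disk word is upward if `x₁ = X`. -/
def Upward (w : Word) : Prop := xLtr w 1 = L.X

/-- A disk word is downward if `x₁ = X⁻¹`. -/
def Downward (w : Word) : Prop := xLtr w 1 = L.Xi

/-- `eps W i = 1` if `xᵢ` has the same sign as `x₁`, and `0` otherwise. -/
def eps (w : Word) (i : ℕ) : ℤ := if xLtr w i = xLtr w 1 then 1 else 0

/-- The height `h(xᵢ)`: `phi (W₁ⁱ) - eps xᵢ` in the upward case and
`phi (W₁ⁱ) + eps xᵢ` in the downward case. -/
def height (w : Word) (i : ℕ) : ℤ :=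
  if xLtr w 1 = L.X then phiPrefix w i - eps w i else phiPrefix w i + eps w i

/-- A word is reduced if it has no adjacent pair of mutually inverse letters. -/
def Reduced (w : Word) : Prop := w.Chain' (fun a b => b ≠ a.inv)

/-- The (0-indexed) positions in `w` of its `X`-letters. -/
def xPos (w : Word) : List ℕ :=
  (List.range w.length).filter (fun i => (w.getD i L.Y).isX)

/-- `subword w i j` = `Wᵢʲ`, the contiguous subword of `w` from the `i`-th
to the `j`-th `X`-letter (1-indexed, inclusive). -/
def subword (w : Word) (i j : ℕ) : Word :=
  (w.take ((xPos w).getD (j - 1) 0 + 1)).drop ((xPos w).getD (i - 1) 0)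

/-- `Y^m`: `m` copies of `Y` if `m ≥ 0`, `-m` copies of `Y⁻¹` if `m < 0`. -/
def Ypow (m : ℤ) : Word :=
  if 0 ≤ m then List.replicate m.toNat L.Y else List.replicate (-m).toNat L.Yi


/-- The level `λ(xᵢ) = phi (W₁ⁱ) - 1` if `xᵢ = X`, and `λ(xᵢ) = phi (W₁ⁱ)` if `xᵢ = X⁻¹`. -/
def level (w : Word) (i : ℕ) : ℤ :=
  if xLtr w i = L.X then phiPrefix w i - 1 else phiPrefix w i

theorem xLetters_append (u v : Word) : xLetters (u ++ v) = xLetters u ++ xLetters v := by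
  simp [xLetters]

theorem xPos_append_singleton (w : Word) (c : L) :
    xPos (w ++ [c]) = xPos w ++ if c.isX then [w.length] else [] := by
  have h : ∀ i ∈ List.range w.length,
      ((w ++ [c]).getD i L.Y).isX = (w.getD i L.Y).isX := by
    intro i hi
    rw [List.getD_append _ _ _ _ (List.mem_range.1 hi)]
  simp only [xPos, List.length_append, List.length_singleton, List.range_succ, List.filter_append,
    List.filter_congr h]
  cases hc : c.isX <;> simp [hc]

theorem length_xPos (w : Word) : (xPos w).length = numX w := by
  induction w using List.reverseRecOn with
  | nil => simp [xPos, numX, xLetters]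
  | append_singleton w c ih =>
    rw [xPos_append_singleton, numX, xLetters_append, List.length_append, List.length_append, ih]
    cases hc : c.isX <;> simp [hc, numX, xLetters]

/-- A word splits at its `i`-th `X`-letter (0-indexed), whose position is recorded by `xPos`. -/
theorem exists_split_at_xPos (w : Word) {i : ℕ} (hi : i < numX w) :
    ∃ u c v, w = u ++ c :: v ∧ c.isX = true ∧ (xPos w).getD i 0 = u.length ∧
      (xLetters u).length = i := by
  induction w using List.reverseRecOn with
  | nil => simp [numX, xLetters] at hi
  | append_singleton w c ih =>
    rw [xPos_append_singleton]
    by_cases h : i < numX w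
    · obtain ⟨u, d, v, hw, hd, hp, hu⟩ := ih h
      refine ⟨u, d, v ++ [c], by simp [hw], hd, ?_, hu⟩
      rw [List.getD_append _ _ _ _ (by rwa [length_xPos]), hp]
    · have hn : numX (w ++ [c]) = numX w + if c.isX then 1 else 0 := by
        rw [numX, xLetters_append, List.length_append]
        cases hc : c.isX <;> simp [hc, numX, xLetters]
      cases hc : c.isX with
      | false => simp [hn, hc] at hi; omega
      | true =>
        have hi' : i = numX w := by simp [hn, hc] at hi; omega
        refine ⟨w, c, [], rfl, hc, ?_, hi'.symm⟩
        rw [List.getD_append_right _ _ _ _ (by rw [length_xPos]; omega), length_xPos, hi']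
        simp

/-- The subword between two `X`-letters starts and ends with an `X`-letter, and its `X`-letters
are the corresponding segment of `X`-letters of the word. -/
theorem subword_spec (w : Word) {a b : ℕ} (ha : 1 ≤ a) (hab : a < b) (hb : b ≤ numX w) :
    ∃ c m d, subword w a b = c :: (m ++ [d]) ∧ c.isX = true ∧ d.isX = true ∧
      xLetters (subword w a b) = ((xLetters w).take b).drop (a - 1) := by
  obtain ⟨u, c, v, hw, hc, hp, hu⟩ := exists_split_at_xPos w (i := a - 1) (by omega)
  obtain ⟨u', d, v', hw', hd, hp', hu'⟩ := exists_split_at_xPos w (i := b - 1) (by omega)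
  obtain ⟨m, hm⟩ : ∃ m, u' = u ++ c :: m := by
    rcases List.append_eq_append_iff.1 (hw.symm.trans hw') with ⟨t, h1, h2⟩ | ⟨t, h1, h2⟩
    · cases t with
      | nil =>
        simp only [List.append_nil] at h1
        subst h1
        omega
      | cons e t =>
        obtain ⟨rfl, -⟩ := List.cons.inj h2
        exact ⟨t, h1⟩
    · rw [h1, xLetters_append, List.length_append] at hu
      omega
  have hs : subword w a b = c :: (m ++ [d]) := by
    have hw'' : w = u ++ ((c :: (m ++ [d])) ++ v') := by rw [hw', hm]; simp
    rw [subword, hp, hp', hw'', ← List.append_assoc, List.take_left' (by simp [hm]; omega),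
      List.drop_left]
  refine ⟨c, m, d, hs, hc, hd, ?_⟩
  have h1 : w = u ++ (subword w a b ++ v') := by rw [hs, hw', hm]; simp
  have h2 : (xLetters (subword w a b)).length = b - a + 1 := by
    have h3 : xLetters u' = xLetters u ++ xLetters (c :: m) := by rw [hm, xLetters_append]
    have h4 := congrArg List.length h3
    rw [List.length_append] at h4
    rw [hs, ← List.cons_append, xLetters_append, List.length_append]
    simp only [xLetters, List.filter_cons, hd] at *
    simp
    omega
  conv_rhs => rw [h1, xLetters_append, xLetters_append]
  rw [List.drop_take, ← hu, List.drop_left, List.take_left' (by omega)]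

theorem phiPrefix_succ (w : Word) {k : ℕ} (hk : k < numX w) :
    phiPrefix w (k + 1) = phiPrefix w k + (xLtr w (k + 1)).sgn := by
  have hk' : k < (xLetters w).length := hk
  rw [phiPrefix, phiPrefix, xLtr, Nat.add_sub_cancel, List.getD_eq_getElem _ _ hk',
    ← List.take_concat_get' _ _ hk', List.map_append, List.sum_append]
  simp

theorem xLtr_eq_X_or_Xi (w : Word) {k : ℕ} (hk : k < numX w) :
    xLtr w (k + 1) = L.X ∨ xLtr w (k + 1) = L.Xi := by
  have hk' : k < (xLetters w).length := hk
  have h : (xLtr w (k + 1)).isX = true := by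
    rw [xLtr, Nat.add_sub_cancel, List.getD_eq_getElem _ _ hk']
    exact (List.mem_filter.1 (List.getElem_mem hk')).2
  revert h
  cases xLtr w (k + 1) <;> simp [L.isX]

/-- The `X`-letter `x_{k+1}` either raises the prefix sum from its level, or lowers the prefix
sum to its level. -/
theorem xLtr_cases (w : Word) {k : ℕ} (hk : k < numX w) :
    ((xLtr w (k + 1)).sgn = 1 ∧ level w (k + 1) = phiPrefix w k ∧
      phiPrefix w (k + 1) = phiPrefix w k + 1) ∨
    ((xLtr w (k + 1)).sgn = -1 ∧ level w (k + 1) = phiPrefix w k - 1 ∧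
      phiPrefix w (k + 1) = phiPrefix w k - 1) := by
  have h := phiPrefix_succ w hk
  rcases xLtr_eq_X_or_Xi w hk with h' | h' <;>
    (simp only [level, h, h', L.sgn]; simp; try omega)

theorem phi_eq_sum_xLetters (w : Word) : phi w = ((xLetters w).map L.sgn).sum := by
  induction w with
  | nil => rfl
  | cons c t ih =>
    simp only [phi, xLetters] at *
    cases c <;> simp [L.isX, L.sgn, ih]

theorem isPrimitive_subword (w : Word) (a b : ℕ) (ha : 1 ≤ a) (hab : a < b) (hb : b ≤ numX w)
    (hl : level w a = level w b) (hne : ∀ j, a < j → j < b → level w j ≠ level w a) :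
    IsPrimitive (subword w a b) := by
  obtain ⟨c, m, d, hs, hc, hd, hx⟩ := subword_spec w ha hab hb
  obtain ⟨a, rfl⟩ : ∃ a', a = a' + 1 := ⟨a - 1, by omega⟩
  obtain ⟨b, rfl⟩ : ∃ b', b = b' + 1 := ⟨b - 1, by omega⟩
  rw [Nat.add_sub_cancel] at hx
  have hn : numX (subword w (a + 1) (b + 1)) = b + 1 - a := by
    have : b + 1 ≤ (xLetters w).length := hb
    rw [numX, hx]
    simp
    omega
  have hltr : ∀ k, k < b + 1 - a →
      xLtr (subword w (a + 1) (b + 1)) (k + 1) = xLtr w (a + k + 1) := by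
    intro k hk
    simp only [xLtr, hx, Nat.add_sub_cancel, List.getD_eq_getElem?_getD, List.getElem?_drop]
    rw [List.getElem?_take_of_lt (by omega)]
  have hpre : ∀ k, k ≤ b + 1 - a →
      phiPrefix (subword w (a + 1) (b + 1)) k = phiPrefix w (a + k) - phiPrefix w a := by
    intro k hk
    induction k with
    | zero => simp [phiPrefix]
    | succ k ih =>
      rw [phiPrefix_succ _ (by omega), hltr k (by omega), ih (by omega), ← add_assoc,
        phiPrefix_succ w (by omega)]
      ring
  have hA := xLtr_cases w (k := a) (by omega)
  have hB := xLtr_cases w (k := b) (by omega)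
  have hside : ((xLtr w (a + 1)).sgn = 1 → ∀ k, a + 1 ≤ k → k ≤ b → phiPrefix w a < phiPrefix w k) ∧
      ((xLtr w (a + 1)).sgn = -1 → ∀ k, a + 1 ≤ k → k ≤ b → phiPrefix w k < phiPrefix w a) := by
    constructor <;>
    · intro h k hk
      induction k, hk using Nat.le_induction with
      | base => intro _; omega
      | succ k hk ih =>
        intro hkb
        have h1 := ih (by omega)
        have h2 := hne (k + 1) (by omega) (by omega)
        have h3 := xLtr_cases w (k := k) (by omega)
        omega
  have hfin : (xLtr w (a + 1)).sgn = -(xLtr w (b + 1)).sgn ∧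
      phiPrefix w (b + 1) = phiPrefix w a := by
    rcases hA with hA | hA
    · have := hside.1 hA.1 b (by omega) le_rfl
      omega
    · have := hside.2 hA.1 b (by omega) le_rfl
      omega
  refine ⟨⟨by omega, ?_, ?_, ?_, ?_⟩, ?_⟩
  · simp [hs, xLetters, hc]
  · rw [hs, ← List.cons_append, xLetters_append, List.getLast?_concat]
    simp [xLetters, hd]
  · have h := hpre (b + 1 - a) le_rfl
    rw [phiPrefix, List.take_of_length_le (le_of_eq hn), ← phi_eq_sum_xLetters,
      show a + (b + 1 - a) = b + 1 by omega] at h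
    omega
  · have h := hltr (b - a) (by omega)
    have h0 := hltr 0 (by omega)
    rw [show a + (b - a) + 1 = b + 1 by omega, show b - a + 1 = b + 1 - a by omega] at h
    rw [hn, h, h0]
    exact hfin.1
  · intro k hk hkn
    rw [hpre k (by omega)]
    rcases hA with hA | hA
    · have := hside.1 hA.1 (a + k) (by omega) (by omega)
      omega
    · have := hside.2 hA.1 (a + k) (by omega) (by omega)
      omega

/-- if `xₐ` and `x_b` (`a < b`) have equal level and no intermediate
`X`-letter has that level, then `Wₐᵇ` is a primitive disk word; consequently any two
`X`-letters of equal level are connected by a chain of primitive disk words. -/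
theorem equal_level_connected_by_primitives (w : Word) :
    (∀ a b, 1 ≤ a → a < b → b ≤ numX w → level w a = level w b →
        (∀ j, a < j → j < b → level w j ≠ level w a) →
        IsPrimitive (subword w a b)) ∧
    (∀ a b, 1 ≤ a → a < b → b ≤ numX w → level w a = level w b →
        ∃ ds : List ℕ, ds.head? = some a ∧ ds.getLast? = some b ∧
          ds.Chain' (· < ·) ∧
          ∀ i, i + 1 < ds.length →
            IsPrimitive (subword w (ds.getD i 0) (ds.getD (i + 1) 0))) := by
  have key := isPrimitive_subword w
  refine ⟨key, fun a b ha hab hb hl => ?_⟩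
  induction hd : b - a using Nat.strong_induction_on generalizing a with
  | _ d ih =>
    by_cases hex : ∃ j, a < j ∧ j < b ∧ level w j = level w a
    · classical
      obtain ⟨h1, h2, h3⟩ := Nat.find_spec hex
      have hmin := fun k => @Nat.find_min _ _ hex k
      generalize Nat.find hex = j at h1 h2 h3 hmin
      obtain ⟨ds, hh, hlast, hch, hp⟩ :=
        ih (b - j) (by omega) j (by omega) h2 (h3.trans hl) rfl
      have hprim : IsPrimitive (subword w a j) :=
        key a j ha h1 (by omega) h3.symm
          fun k hk hkj hlk => hmin k hkj ⟨hk, by omega, hlk⟩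
      cases ds with
      | nil => simp at hh
      | cons e t =>
        obtain rfl : e = j := by simpa using hh
        refine ⟨a :: e :: t, by simp, by simpa using hlast,
          List.isChain_cons_cons.2 ⟨h1, hch⟩, ?_⟩
        rintro (_ | i) hi
        · simpa using hprim
        · simpa using hp i (by simpa using hi)
    · push Not at hex
      refine ⟨[a, b], by simp, by simp, List.isChain_pair.2 hab, ?_⟩
      rintro (_ | i) hi
      · simpa using key a b ha hab hb hl hex
      · simp at hi
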